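/- arXiv:2401.01168 — 6 statements merged into one kernel-verified Lean document; each statement's English description precedes it below -/
import Mathlib

section
/- Let H be a real inner product space, and let f : H → ℝ be differentiable with gradient ∇f. Assume f is convex and L-smooth with 0 < L. Then for all x, y ∈ H: ⟪∇f(x) − ∇f(y), x − y⟫ ≥ (1/L)·‖∇f(x) − ∇f(y)‖². -/
open scoped InnerProductSpace

section Gradient

variable {H : Type*} [NormedAddCommGroup H] [InnerProductSpace ℝ H] [CompleteSpace H]
  {f : H → ℝ} {g : H → H} {L : ℝ}

lemma HasGradientAt.hasDerivAt_comp_add_smul {x v w : H} {t : ℝ}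
    (h : HasGradientAt f w (x + t • v)) :
    HasDerivAt (fun s : ℝ => f (x + s • v)) ⟪w, v⟫_ℝ t := by
  have hline : HasDerivAt (fun s : ℝ => x + s • v) v t := by
    simpa using ((hasDerivAt_id t).smul_const v).const_add x
  simpa [Function.comp_def] using h.hasFDerivAt.comp_hasDerivAt t hline

/-- A convex function lies above its tangent hyperplanes. -/
lemma ConvexOn.add_inner_gradient_le (hconv : ConvexOn ℝ Set.univ f) {x w : H}
    (h : HasGradientAt f w x) (v : H) : f x + ⟪w, v⟫_ℝ ≤ f (x + v) := by
  have hc : ConvexOn ℝ Set.univ (fun t : ℝ => f (x + t • v)) := by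
    refine ⟨convex_univ, fun s _ t _ a b ha hb hab => ?_⟩
    have key := hconv.2 (Set.mem_univ (x + s • v)) (Set.mem_univ (x + t • v)) ha hb hab
    have hx : a • (x + s • v) + b • (x + t • v) = x + (a • s + b • t) • v := by
      obtain rfl : b = 1 - a := by linarith
      simp only [smul_eq_mul]
      module
    rwa [hx] at key
  have hd : HasDerivAt (fun t : ℝ => f (x + t • v)) ⟪w, v⟫_ℝ 0 :=
    HasGradientAt.hasDerivAt_comp_add_smul (by simpa using h)
  have := hc.le_slope_of_hasDerivAt (Set.mem_univ 0) (Set.mem_univ 1) one_pos hd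
  simp only [slope_def_field, one_smul, zero_smul, add_zero, sub_zero, div_one] at this
  linarith

/-- The descent lemma: a function with `L`-Lipschitz gradient is bounded above by its
quadratic model. -/
lemma le_add_inner_gradient_add_sq (hgrad : ∀ x, HasGradientAt f (g x) x)
    (hsmooth : ∀ x y, ‖g x - g y‖ ≤ L * ‖x - y‖) (x v : H) :
    f (x + v) ≤ f x + ⟪g x, v⟫_ℝ + L / 2 * ‖v‖ ^ 2 := by
  have hd (t : ℝ) : HasDerivAt
      (fun s : ℝ => f (x + s • v) - s * ⟪g x, v⟫_ℝ - L / 2 * ‖v‖ ^ 2 * s ^ 2)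
      (⟪g (x + t • v), v⟫_ℝ - ⟪g x, v⟫_ℝ - L * ‖v‖ ^ 2 * t) t := by
    have h := (((hgrad (x + t • v)).hasDerivAt_comp_add_smul).sub
      ((hasDerivAt_id t).mul_const ⟪g x, v⟫_ℝ)).sub
      (((hasDerivAt_id t).pow 2).const_mul (L / 2 * ‖v‖ ^ 2))
    refine h.congr_deriv ?_
    simp
    ring
  have hanti := antitoneOn_of_deriv_nonpos (convex_Icc (0 : ℝ) 1)
    (fun t _ => (hd t).continuousAt.continuousWithinAt)
    (fun t _ => (hd t).differentiableAt.differentiableWithinAt) (fun t ht => by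
      rw [interior_Icc] at ht
      rw [(hd t).deriv, ← inner_sub_left]
      have h₁ := real_inner_le_norm (g (x + t • v) - g x) v
      have h₂ := hsmooth (x + t • v) x
      rw [add_sub_cancel_left, norm_smul, Real.norm_of_nonneg ht.1.le] at h₂
      nlinarith [mul_le_mul_of_nonneg_right h₂ (norm_nonneg v)])
  have := hanti (Set.left_mem_Icc.2 zero_le_one) (Set.right_mem_Icc.2 zero_le_one) zero_le_one
  simp only [one_smul, zero_smul, add_zero] at this
  linarith

lemma ConvexOn.add_inner_add_sq_norm_gradient_sub_le (hconv : ConvexOn ℝ Set.univ f)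
    (hL : 0 < L) (hgrad : ∀ x, HasGradientAt f (g x) x)
    (hsmooth : ∀ x y, ‖g x - g y‖ ≤ L * ‖x - y‖) (x y : H) :
    f y + ⟪g y, x - y⟫_ℝ + 1 / (2 * L) * ‖g x - g y‖ ^ 2 ≤ f x := by
  set d := g x - g y with hd
  have h₁ := hconv.add_inner_gradient_le (hgrad y) (x - y + (-(1 / L)) • d)
  have h₂ := le_add_inner_gradient_add_sq hgrad hsmooth x ((-(1 / L)) • d)
  rw [show y + (x - y + (-(1 / L)) • d) = x + (-(1 / L)) • d by abel, inner_add_right,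
    inner_smul_right] at h₁
  rw [inner_smul_right, norm_smul, mul_pow, Real.norm_eq_abs, sq_abs] at h₂
  have h₃ : ⟪g x, d⟫_ℝ - ⟪g y, d⟫_ℝ = ‖d‖ ^ 2 := by
    rw [← inner_sub_left, ← hd, real_inner_self_eq_norm_sq]
  have h₄ : L / 2 * ((-(1 / L)) ^ 2 * ‖d‖ ^ 2) = 1 / (2 * L) * ‖d‖ ^ 2 := by
    field_simp
  have h₅ : 1 / L * ⟪g x, d⟫_ℝ - 1 / L * ⟪g y, d⟫_ℝ = 2 * (1 / (2 * L) * ‖d‖ ^ 2) := by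
    rw [← mul_sub, h₃]
    field_simp
  linarith

end Gradient

/-- Co-coercivity of the gradient of a convex `L`-smooth function:
`⟪g x - g y, x - y⟫ ≥ (1/L)·‖g x - g y‖²`. -/
theorem fedqv_cocoercivity
    {H : Type*} [NormedAddCommGroup H] [InnerProductSpace ℝ H] [CompleteSpace H]
    (f : H → ℝ) (g : H → H) (L : ℝ) (hL : 0 < L)
    (hgrad : ∀ x, HasGradientAt f (g x) x)
    (hconv : ConvexOn ℝ Set.univ f)
    (hsmooth : ∀ x y, ‖g x - g y‖ ≤ L * ‖x - y‖) :
    ∀ x y, ⟪g x - g y, x - y⟫_ℝ ≥ (1 / L) * ‖g x - g y‖ ^ 2 := by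
  intro x y
  have h₁ := hconv.add_inner_add_sq_norm_gradient_sub_le hL hgrad hsmooth x y
  have h₂ := hconv.add_inner_add_sq_norm_gradient_sub_le hL hgrad hsmooth y x
  rw [norm_sub_rev (g y), ← neg_sub x y, inner_neg_right] at h₂
  have h₃ : 1 / L * ‖g x - g y‖ ^ 2 = 2 * (1 / (2 * L) * ‖g x - g y‖ ^ 2) := by
    field_simp
  rw [inner_sub_left]
  linarith
end

section
/- Let H be a real inner product space and let f : H → ℝ be differentiable with gradient ∇f, L-smooth and μ-strongly convex with 0 < μ ≤ L, and suppose ∇f(w*) = 0 for some w* ∈ H. Let I be a finite index set, p : I → ℝ nonnegative weights with ∑_{i∈I} p_i = 1, points w_i ∈ H, w := ∑_{i∈I} p_i·w_i, and g := ∑_{i∈I} p_i·∇f(w_i). If 0 < r and r·(L + μ) ≤ 1, then ‖w − r·g − w*‖² ≤ ∑_{i∈I} p_i·‖w − w_i‖² + (1 − 2·r·L·μ/(L + μ))·‖w − w*‖². -/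
open scoped InnerProductSpace
open Finset

/-- The descent lemma: a function with `L`-Lipschitz gradient lies below the quadratic with
curvature `L` that is tangent to it at `x`. -/
theorem HasGradientAt.le_quadratic_of_lipschitz
    {H : Type*} [NormedAddCommGroup H] [InnerProductSpace ℝ H] [CompleteSpace H]
    {f : H → ℝ} {g : H → H} {L : ℝ} (hgrad : ∀ x, HasGradientAt f (g x) x)
    (hsmooth : ∀ x y, ‖g x - g y‖ ≤ L * ‖x - y‖) (x v : H) :
    f (x + v) ≤ f x + ⟪g x, v⟫_ℝ + L / 2 * ‖v‖ ^ 2 := by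
  have hline (t : ℝ) : HasDerivAt (fun s : ℝ => x + s • v) v t := by
    simpa using ((hasDerivAt_id t).smul_const v).const_add x
  have hderiv (t : ℝ) : HasDerivAt
      (fun s : ℝ => f (x + s • v) - s * ⟪g x, v⟫_ℝ - L / 2 * ‖v‖ ^ 2 * s ^ 2)
      (⟪g (x + t • v), v⟫_ℝ - ⟪g x, v⟫_ℝ - L / 2 * ‖v‖ ^ 2 * (2 * t)) t := by
    have hf : HasDerivAt (fun s : ℝ => f (x + s • v)) ⟪g (x + t • v), v⟫_ℝ t := by
      exact ((hgrad (x + t • v)).hasFDerivAt.comp_hasDerivAt t (hline t)).congr_deriv (by simp)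
    have hlin := (hasDerivAt_id t).mul_const ⟪g x, v⟫_ℝ
    have hsq := ((hasDerivAt_id t).pow 2).const_mul (L / 2 * ‖v‖ ^ 2)
    exact ((hf.sub hlin).sub hsq).congr_deriv (by simp)
  have hanti : AntitoneOn
      (fun s : ℝ => f (x + s • v) - s * ⟪g x, v⟫_ℝ - L / 2 * ‖v‖ ^ 2 * s ^ 2) (Set.Ici 0) := by
    refine antitoneOn_of_deriv_nonpos (convex_Ici 0)
      (fun t _ => (hderiv t).continuousAt.continuousWithinAt)
      (fun t _ => (hderiv t).differentiableAt.differentiableWithinAt) fun t ht => ?_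
    rw [interior_Ici, Set.mem_Ioi] at ht
    have hlip : ‖g (x + t • v) - g x‖ ≤ L * (t * ‖v‖) := by
      simpa [norm_smul, abs_of_pos ht] using hsmooth (x + t • v) x
    have hcs := real_inner_le_norm (g (x + t • v) - g x) v
    rw [inner_sub_left] at hcs
    rw [(hderiv t).deriv]
    nlinarith [mul_le_mul_of_nonneg_right hlip (norm_nonneg v)]
  have := hanti (Set.mem_Ici.2 le_rfl) (Set.mem_Ici.2 zero_le_one) zero_le_one
  simp only [one_smul, zero_smul, add_zero] at this
  linarith

/-- Strengthened coercivity of the gradient of an `L`-smooth, `μ`-strongly convex function. -/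
theorem HasGradientAt.norm_sq_add_norm_sq_le_inner
    {H : Type*} [NormedAddCommGroup H] [InnerProductSpace ℝ H] [CompleteSpace H]
    {f : H → ℝ} {g : H → H} {L μ : ℝ} (hμ : 0 < μ) (hμL : μ ≤ L)
    (hgrad : ∀ x, HasGradientAt f (g x) x)
    (hsmooth : ∀ x y, ‖g x - g y‖ ≤ L * ‖x - y‖)
    (hsc : ∀ x y, f x ≥ f y + ⟪g y, x - y⟫_ℝ + (μ / 2) * ‖x - y‖ ^ 2) (x y : H) :
    ‖g x - g y‖ ^ 2 + L * μ * ‖x - y‖ ^ 2 ≤ (L + μ) * ⟪g x - g y, x - y⟫_ℝ := by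
  have hexpand (x y : H) : ‖(g x - g y) - μ • (x - y)‖ ^ 2 =
      ‖g x - g y‖ ^ 2 - 2 * μ * ⟪g x - g y, x - y⟫_ℝ + μ ^ 2 * ‖x - y‖ ^ 2 := by
    rw [norm_sub_sq_real, inner_smul_right, norm_smul, mul_pow, Real.norm_eq_abs, sq_abs]
    ring
  rcases hμL.eq_or_lt with rfl | hlt
  · have hmono : μ * ‖x - y‖ ^ 2 ≤ ⟪g x - g y, x - y⟫_ℝ := by
      have hxy := hsc x y
      have hyx := hsc y x
      rw [← neg_sub x y, inner_neg_right, norm_neg] at hyx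
      rw [inner_sub_left]
      linarith
    have hsq := pow_le_pow_left₀ (norm_nonneg _) (hsmooth x y) 2
    nlinarith [mul_le_mul_of_nonneg_left hmono hμ.le]
  · have hpos : 0 < L - μ := sub_pos.2 hlt
    have hgap (x y : H) : ‖(g x - g y) - μ • (x - y)‖ ^ 2 ≤
        2 * (L - μ) * (f x - f y - ⟪g y, x - y⟫_ℝ - μ / 2 * ‖x - y‖ ^ 2) := by
      set e := (g x - g y) - μ • (x - y) with he
      set v := (-(L - μ)⁻¹) • e with hv
      have hup := HasGradientAt.le_quadratic_of_lipschitz hgrad hsmooth x v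
      have hlow := hsc (x + v) y
      have hxv : x + v - y = (x - y) + v := by abel
      have hev : ⟪e, v⟫_ℝ = ⟪g x, v⟫_ℝ - ⟪g y, v⟫_ℝ - μ * ⟪x - y, v⟫_ℝ := by
        rw [he, inner_sub_left, inner_sub_left, real_inner_smul_left]
      have hev' : ⟪e, v⟫_ℝ = -(L - μ)⁻¹ * ‖e‖ ^ 2 := by
        rw [hv, inner_smul_right, real_inner_self_eq_norm_sq]
      have hvv : ‖v‖ ^ 2 = (L - μ)⁻¹ ^ 2 * ‖e‖ ^ 2 := by
        rw [hv, norm_smul, mul_pow, Real.norm_eq_abs, sq_abs, neg_sq]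
      rw [hxv, inner_add_right, norm_add_sq_real] at hlow
      have hkey : (L - μ)⁻¹ * ‖e‖ ^ 2 - (L - μ) / 2 * ((L - μ)⁻¹ ^ 2 * ‖e‖ ^ 2) ≤
          f x - f y - ⟪g y, x - y⟫_ℝ - μ / 2 * ‖x - y‖ ^ 2 := by
        rw [← hvv]
        linarith
      calc ‖e‖ ^ 2 = 2 * (L - μ) *
            ((L - μ)⁻¹ * ‖e‖ ^ 2 - (L - μ) / 2 * ((L - μ)⁻¹ ^ 2 * ‖e‖ ^ 2)) := by
            field_simp
            ring
        _ ≤ _ := by gcongr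
    have hxy := hgap x y
    have hyx := hgap y x
    rw [hexpand] at hxy hyx
    rw [← neg_sub x y, ← neg_sub (g x) (g y), inner_neg_neg, inner_neg_right, norm_neg,
      norm_neg] at hyx
    have hinner : ⟪g x - g y, x - y⟫_ℝ = ⟪g x, x - y⟫_ℝ - ⟪g y, x - y⟫_ℝ := inner_sub_left _ _ _
    rw [hinner] at hxy hyx ⊢
    linarith

/-- Jensen's inequality for the squared norm. -/
theorem norm_sum_smul_sq_le
    {H : Type*} [SeminormedAddCommGroup H] [NormedSpace ℝ H] {ι : Type*} [Fintype ι]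
    {p : ι → ℝ} (hp : ∀ i, 0 ≤ p i) (hpsum : ∑ i, p i = 1) (v : ι → H) :
    ‖∑ i, p i • v i‖ ^ 2 ≤ ∑ i, p i * ‖v i‖ ^ 2 :=
  (convexOn_univ_norm.pow (fun _ _ => norm_nonneg _) 2).map_sum_le
    (fun i _ => hp i) hpsum (fun _ _ => Set.mem_univ _)

/-- One-step descent bound (Lemma 3 of the paper): a weighted-average gradient step
computed at heterogeneous local points contracts the distance to the optimum up to
the client-drift term. -/
theorem fedqv_one_step_descent
    {H : Type*} [NormedAddCommGroup H] [InnerProductSpace ℝ H] [CompleteSpace H]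
    {ι : Type*} [Fintype ι]
    (f : H → ℝ) (g : H → H) (L μ : ℝ) (hμ : 0 < μ) (hμL : μ ≤ L)
    (hgrad : ∀ x, HasGradientAt f (g x) x)
    (hsmooth : ∀ x y, ‖g x - g y‖ ≤ L * ‖x - y‖)
    (hsc : ∀ x y, f x ≥ f y + ⟪g y, x - y⟫_ℝ + (μ / 2) * ‖x - y‖ ^ 2)
    (wstar : H) (hstar : g wstar = 0)
    (p : ι → ℝ) (hp : ∀ i, 0 ≤ p i) (hpsum : ∑ i, p i = 1)
    (w : ι → H) (wbar gbar : H)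
    (hwbar : wbar = ∑ i, p i • w i)
    (hgbar : gbar = ∑ i, p i • g (w i))
    (r : ℝ) (hr : 0 < r) (hrL : r * (L + μ) ≤ 1) :
    ‖wbar - r • gbar - wstar‖ ^ 2 ≤
      (∑ i, p i * ‖wbar - w i‖ ^ 2) +
        (1 - 2 * r * L * μ / (L + μ)) * ‖wbar - wstar‖ ^ 2 := by
  have hLμ : 0 < L + μ := by linarith
  have hcoer (i : ι) :
      ‖g (w i)‖ ^ 2 + L * μ * ‖w i - wstar‖ ^ 2 ≤ (L + μ) * ⟪g (w i), w i - wstar⟫_ℝ := by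
    simpa [hstar] using
      HasGradientAt.norm_sq_add_norm_sq_le_inner hμ hμL hgrad hsmooth hsc (w i) wstar
  have hlocal (i : ι) :
      -(2 * r) * ⟪g (w i), wbar - wstar⟫_ℝ + r ^ 2 * ‖g (w i)‖ ^ 2 ≤
        ‖wbar - w i‖ ^ 2 - 2 * r * L * μ / (L + μ) * ‖w i - wstar‖ ^ 2 := by
    have hsplit : ⟪g (w i), wbar - wstar⟫_ℝ =
        ⟪g (w i), wbar - w i⟫_ℝ + ⟪g (w i), w i - wstar⟫_ℝ := by
      rw [← inner_add_right, sub_add_sub_cancel]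
    have hyoung : 0 ≤ ‖wbar - w i‖ ^ 2 + 2 * r * ⟪g (w i), wbar - w i⟫_ℝ +
        r ^ 2 * ‖g (w i)‖ ^ 2 := by
      have h := norm_add_sq_real (wbar - w i) (r • g (w i))
      rw [inner_smul_right, real_inner_comm, norm_smul, mul_pow, Real.norm_eq_abs,
        sq_abs] at h
      nlinarith [sq_nonneg ‖wbar - w i + r • g (w i)‖]
    have hdrop : r ^ 2 * ‖g (w i)‖ ^ 2 + L * μ / (L + μ) * r * ‖w i - wstar‖ ^ 2 ≤
        r * ⟪g (w i), w i - wstar⟫_ℝ := by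
      refine le_of_mul_le_mul_left ?_ hLμ
      have hstep := mul_le_mul_of_nonneg_right hrL
        (mul_nonneg hr.le (sq_nonneg ‖g (w i)‖))
      have hscaled := mul_le_mul_of_nonneg_left (hcoer i) hr.le
      have hcancel : (L + μ) * (L * μ / (L + μ)) = L * μ := mul_div_cancel₀ _ hLμ.ne'
      linear_combination hstep + hscaled + r * ‖w i - wstar‖ ^ 2 * hcancel
    rw [hsplit]
    linear_combination hyoung + 2 * hdrop
  have hsum := Finset.sum_le_sum fun i (_ : i ∈ univ) =>
    mul_le_mul_of_nonneg_left (hlocal i) (hp i)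
  have hleft : ∑ i, p i * (-(2 * r) * ⟪g (w i), wbar - wstar⟫_ℝ + r ^ 2 * ‖g (w i)‖ ^ 2) =
      -(2 * r) * ⟪gbar, wbar - wstar⟫_ℝ + r ^ 2 * ∑ i, p i * ‖g (w i)‖ ^ 2 := by
    rw [hgbar, sum_inner, mul_sum, mul_sum, ← sum_add_distrib]
    refine sum_congr rfl fun i _ => ?_
    rw [real_inner_smul_left]
    ring
  have hright : ∑ i, p i *
      (‖wbar - w i‖ ^ 2 - 2 * r * L * μ / (L + μ) * ‖w i - wstar‖ ^ 2) =
      ∑ i, p i * ‖wbar - w i‖ ^ 2 -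
        2 * r * L * μ / (L + μ) * ∑ i, p i * ‖w i - wstar‖ ^ 2 := by
    rw [mul_sum, ← sum_sub_distrib]
    exact sum_congr rfl fun i _ => by ring
  have hgnorm : ‖gbar‖ ^ 2 ≤ ∑ i, p i * ‖g (w i)‖ ^ 2 :=
    hgbar ▸ norm_sum_smul_sq_le hp hpsum fun i => g (w i)
  have hwnorm : ‖wbar - wstar‖ ^ 2 ≤ ∑ i, p i * ‖w i - wstar‖ ^ 2 := by
    have h := norm_sum_smul_sq_le hp hpsum fun i => w i - wstar
    simpa only [smul_sub, sum_sub_distrib, ← sum_smul, hpsum, one_smul, ← hwbar] using h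
  have hL : 0 < L := hμ.trans_le hμL
  have hgnorm' := mul_le_mul_of_nonneg_left hgnorm (sq_nonneg r)
  have hwnorm' := mul_le_mul_of_nonneg_left hwnorm
    (show 0 ≤ 2 * r * L * μ / (L + μ) by positivity)
  have hexpand : ‖wbar - r • gbar - wstar‖ ^ 2 =
      ‖wbar - wstar‖ ^ 2 - 2 * r * ⟪gbar, wbar - wstar⟫_ℝ + r ^ 2 * ‖gbar‖ ^ 2 := by
    rw [sub_right_comm, norm_sub_sq_real, inner_smul_right, real_inner_comm, norm_smul,
      mul_pow, Real.norm_eq_abs, sq_abs]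
    ring
  rw [hleft, hright] at hsum
  rw [hexpand]
  linarith
end

section
/- Let H be a real inner product space, I a finite index set, p : I → ℝ nonnegative weights with ∑_{i∈I} p_i = 1, and let E ≥ 1 be a natural number, r ≥ 0, G ≥ 0, and w₀ ∈ H. Suppose for each i ∈ I there is a natural number k_i ≤ E − 1 and vectors g_{i,1}, …, g_{i,k_i} ∈ H with ‖g_{i,j}‖ ≤ G such that w_i = w₀ − r·∑_{j=1}^{k_i} g_{i,j}. Let w̄ := ∑_{i∈I} p_i·w_i. Then ∑_{i∈I} p_i·‖w̄ − w_i‖² ≤ (E − 1)²·r²·G². -/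
open Finset

/-- The weighted mean square deviation is smallest around the weighted mean. -/
theorem sum_mul_norm_sub_mean_sq_le
    {H : Type*} [NormedAddCommGroup H] [InnerProductSpace ℝ H] {ι : Type*} [Fintype ι]
    (p : ι → ℝ) (hpsum : ∑ i, p i = 1) (w : ι → H) (a : H) :
    ∑ i, p i * ‖∑ j, p j • w j - w i‖ ^ 2 ≤ ∑ i, p i * ‖w i - a‖ ^ 2 := by
  set m := ∑ j, p j • w j with hm
  have hma : m - a = ∑ i, p i • (w i - a) := by
    simp only [smul_sub, sum_sub_distrib, ← sum_smul, hpsum, one_smul, hm]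
  have hinner : ∑ i, p i * inner ℝ (w i - a) (m - a) = ‖m - a‖ ^ 2 := by
    rw [← real_inner_self_eq_norm_sq]
    nth_rw 2 [hma]
    simp only [sum_inner, real_inner_smul_left]
  have hterm (i : ι) : p i * ‖m - w i‖ ^ 2 =
      p i * ‖w i - a‖ ^ 2 - 2 * (p i * inner ℝ (w i - a) (m - a)) + p i * ‖m - a‖ ^ 2 := by
    rw [norm_sub_rev, ← sub_sub_sub_cancel_right (w i) m a, norm_sub_sq_real]
    ring
  simp only [hterm, sum_add_distrib, sum_sub_distrib, ← mul_sum, ← sum_mul, hpsum, hinner]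
  linarith [sq_nonneg ‖m - a‖]

/-- Client-drift bound (Lemma 5 of the paper): if each local model `w i` is obtained
from the common synchronization point `w₀` by at most `E - 1` gradient steps of step
size `r`, each gradient of norm at most `G`, then the weighted client drift around the
weighted average is bounded by `(E - 1)²·r²·G²`. -/
theorem fedqv_client_drift_bound
    {H : Type*} [NormedAddCommGroup H] [InnerProductSpace ℝ H]
    {ι : Type*} [Fintype ι]
    (p : ι → ℝ) (hp : ∀ i, 0 ≤ p i) (hpsum : ∑ i, p i = 1)
    (E : ℕ) (hE : 1 ≤ E) (r G : ℝ) (hr : 0 ≤ r) (hG : 0 ≤ G)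
    (w₀ : H) (w : ι → H)
    (hsteps : ∀ i, ∃ (k : ℕ), k ≤ E - 1 ∧ ∃ gs : Fin k → H,
      (∀ j, ‖gs j‖ ≤ G) ∧ w i = w₀ - r • ∑ j, gs j)
    (wbar : H) (hwbar : wbar = ∑ i, p i • w i) :
    ∑ i, p i * ‖wbar - w i‖ ^ 2 ≤ ((E : ℝ) - 1) ^ 2 * r ^ 2 * G ^ 2 := by
  subst hwbar
  have hdist (i : ι) : ‖w i - w₀‖ ≤ ((E : ℝ) - 1) * r * G := by
    obtain ⟨k, hk, gs, hgs, hw⟩ := hsteps i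
    have hk' : (k : ℝ) ≤ (E : ℝ) - 1 := by
      rw [le_sub_iff_add_le]
      exact_mod_cast (show k + 1 ≤ E by omega)
    have hsum : ‖∑ j, gs j‖ ≤ k * G := by
      simpa using norm_sum_le_of_le univ fun j _ => hgs j
    calc ‖w i - w₀‖ = r * ‖∑ j, gs j‖ := by
          rw [hw, sub_sub_cancel_left, norm_neg, norm_smul, Real.norm_of_nonneg hr]
      _ ≤ r * (((E : ℝ) - 1) * G) := by
          gcongr
          exact hsum.trans (by gcongr)
      _ = ((E : ℝ) - 1) * r * G := by ring
  calc _ ≤ ∑ i, p i * ‖w i - w₀‖ ^ 2 := sum_mul_norm_sub_mean_sq_le p hpsum w w₀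
    _ ≤ ∑ i, p i * (((E : ℝ) - 1) * r * G) ^ 2 := by
        gcongr with i
        · exact hp i
        · exact hdist i
    _ = ((E : ℝ) - 1) ^ 2 * r ^ 2 * G ^ 2 := by
        rw [← sum_mul, hpsum]
        ring
end

section
/- Let H be a real inner product space, a, b ∈ H, and θ ∈ ℝ with 0 ≤ θ ≤ 1. If ⟪a, b⟫ ≤ (1 − θ)·‖a‖·‖b‖, then √(θ·(2 − θ))·‖a‖ ≤ ‖a − b‖, and consequently (√(θ·(2 − θ)) − 1)·‖a‖ ≤ ‖b‖. -/
open scoped InnerProductSpace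

/-- Intermediate bounds in the proof of Theorem 1: if the cosine similarity between
`a` and `b` is at most `1 - θ`, then `√(θ(2-θ))·‖a‖ ≤ ‖a - b‖`, and consequently
`(√(θ(2-θ)) - 1)·‖a‖ ≤ ‖b‖`. -/
theorem fedqv_distance_norm_bounds
    {H : Type*} [NormedAddCommGroup H] [InnerProductSpace ℝ H]
    (a b : H) (θ : ℝ) (hθ0 : 0 ≤ θ) (hθ1 : θ ≤ 1)
    (h : ⟪a, b⟫_ℝ ≤ (1 - θ) * ‖a‖ * ‖b‖) :
    Real.sqrt (θ * (2 - θ)) * ‖a‖ ≤ ‖a - b‖ ∧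
      (Real.sqrt (θ * (2 - θ)) - 1) * ‖a‖ ≤ ‖b‖ := by
  have hdist : Real.sqrt (θ * (2 - θ)) * ‖a‖ ≤ ‖a - b‖ := by
    have hθ : 0 ≤ θ * (2 - θ) := mul_nonneg hθ0 (by linarith)
    refine abs_le_of_sq_le_sq' ?_ (norm_nonneg _) |>.2
    rw [mul_pow, Real.sq_sqrt hθ, norm_sub_sq_real]
    nlinarith [sq_nonneg (‖b‖ - (1 - θ) * ‖a‖)]
  exact ⟨hdist, by linarith [norm_sub_le a b]⟩
end

section
/- Let H be a real inner product space, a, b ∈ H, and θ ∈ ℝ with 0 ≤ θ ≤ 1. If ⟪a, b⟫ ≥ θ·‖a‖·‖b‖ and ‖b‖ ≤ (1 + θ + √(θ·(2 − θ)))·‖a‖, then ‖a − b‖² ≤ (4 + 6·θ − θ²)·‖a‖². -/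
open scoped InnerProductSpace

/-- Key perturbation bound of Theorem 1: any update `b` passing FedQV's similarity
filter deviates from the honest gradient `a` by at most `√(4 + 6θ - θ²)` times the
honest gradient's norm. -/
theorem fedqv_perturbation_bound
    {H : Type*} [NormedAddCommGroup H] [InnerProductSpace ℝ H]
    (a b : H) (θ : ℝ) (hθ0 : 0 ≤ θ) (hθ1 : θ ≤ 1)
    (hsim : ⟪a, b⟫_ℝ ≥ θ * ‖a‖ * ‖b‖)
    (hnorm : ‖b‖ ≤ (1 + θ + Real.sqrt (θ * (2 - θ))) * ‖a‖) :
    ‖a - b‖ ^ 2 ≤ (4 + 6 * θ - θ ^ 2) * ‖a‖ ^ 2 := by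
  set s := Real.sqrt (θ * (2 - θ))
  have hs0 : 0 ≤ s := Real.sqrt_nonneg _
  have hs2 : s ^ 2 = θ * (2 - θ) := Real.sq_sqrt (mul_nonneg hθ0 (by linarith))
  have hs1 : s ≤ 1 := by nlinarith [sq_nonneg (1 - θ)]
  have ha : 0 ≤ ‖a‖ := norm_nonneg a
  have hb : 0 ≤ ‖b‖ := norm_nonneg b
  have hgap : 0 ≤ (1 - θ + s) * ‖a‖ := mul_nonneg (by linarith) ha
  have hprod : 0 ≤ ((1 + θ + s) * ‖a‖ - ‖b‖) * ((1 - θ + s) * ‖a‖ + ‖b‖) :=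
    mul_nonneg (by linarith) (by linarith)
  have hcoeff : 1 + (1 + θ + s) * (1 - θ + s) ≤ 4 + 6 * θ - θ ^ 2 := by
    nlinarith [sq_nonneg θ]
  rw [norm_sub_sq_real]
  calc ‖a‖ ^ 2 - 2 * ⟪a, b⟫_ℝ + ‖b‖ ^ 2
      ≤ ‖a‖ ^ 2 - 2 * (θ * ‖a‖ * ‖b‖) + ‖b‖ ^ 2 := by linarith
    _ ≤ (1 + (1 + θ + s) * (1 - θ + s)) * ‖a‖ ^ 2 := by linarith
    _ ≤ (4 + 6 * θ - θ ^ 2) * ‖a‖ ^ 2 := by gcongr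
end

section
/- Let L, μ, α, β, Δ be real numbers with 0 < L, 0 < μ, Δ ≥ 0, β ≥ 1, 2·α·μ·L > L + μ, and 2·L·μ·α ≤ (L + μ)·β. Let γ := max{ (L + μ)·α²·Δ/(2·α·μ·L − L − μ), β·x₀ }, and let x : ℕ → ℝ be a nonnegative sequence satisfying x_{t+1} ≤ (1 − 2·L·μ·α/((L + μ)·(β + t)))·x_t + α²·Δ/(β + t)² for all t ∈ ℕ, with x₀ = x 0. Then for all t ∈ ℕ: x_t ≤ γ/(β + t). -/
/-- A sequence with `x (t + 1) ≤ (1 - c/(β + t)) x t + D/(β + t)²` with `c ≤ β`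
decays like `γ/(β + t)` as soon as `β x 0 ≤ γ` and `D ≤ (c - 1) γ`. -/
theorem le_div_add_of_recursion {c β D γ : ℝ} {x : ℕ → ℝ} (hβ : 0 < β) (hcβ : c ≤ β)
    (hγ : 0 ≤ γ) (hx : β * x 0 ≤ γ) (hD : D ≤ (c - 1) * γ)
    (hrec : ∀ t : ℕ, x (t + 1) ≤ (1 - c / (β + t)) * x t + D / (β + t) ^ 2) (t : ℕ) :
    x t ≤ γ / (β + t) := by
  induction t with
  | zero =>
    rw [Nat.cast_zero, add_zero, le_div_iff₀ hβ]
    linarith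
  | succ t ih =>
    have ht : (0 : ℝ) ≤ t := t.cast_nonneg
    have hs : 0 < β + t := by positivity
    have hcoef : 0 ≤ 1 - c / (β + t) := by
      rw [sub_nonneg, div_le_one hs]
      linarith
    calc x (t + 1) ≤ (1 - c / (β + t)) * x t + D / (β + t) ^ 2 := hrec t
      _ ≤ (1 - c / (β + t)) * (γ / (β + t)) + (c - 1) * γ / (β + t) ^ 2 := by gcongr
      _ = (β + t - 1) * γ / (β + t) ^ 2 := by
        field_simp
        ring
      _ ≤ γ / (β + (t + 1 : ℕ)) := by
        push_cast
        rw [div_le_div_iff₀ (by positivity) (by positivity)]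
        linarith


/-- Inductive proposition inside Theorem 3 of the paper: with diminishing learning
rate `r t = α/(β + t)`, a nonnegative sequence satisfying the per-step recursion
decays at rate `O(1/t)`:  `x t ≤ γ/(β + t)` where
`γ = max ((L+μ)·α²·Δ/(2αμL - L - μ)) (β·x 0)`. -/
theorem fedqv_recursion_decay
    (L μ α β Δ : ℝ) (hL : 0 < L) (hμ : 0 < μ) (hΔ : 0 ≤ Δ) (hβ : 1 ≤ β)
    (hα : 2 * α * μ * L > L + μ) (hαβ : 2 * L * μ * α ≤ (L + μ) * β)
    (x : ℕ → ℝ) (hx : ∀ t, 0 ≤ x t)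
    (hrec : ∀ t : ℕ, x (t + 1) ≤
      (1 - 2 * L * μ * α / ((L + μ) * (β + t))) * x t + α ^ 2 * Δ / (β + t) ^ 2) :
    ∀ t : ℕ,
      x t ≤ max ((L + μ) * α ^ 2 * Δ / (2 * α * μ * L - L - μ)) (β * x 0) / (β + t) := by
  have hsum : 0 < L + μ := by positivity
  have hgap : 0 < 2 * α * μ * L - L - μ := by linarith
  refine le_div_add_of_recursion (c := 2 * L * μ * α / (L + μ)) (D := α ^ 2 * Δ)
    (by linarith) ?_ ?_ (le_max_right _ _) ?_ fun t => ?_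
  · rw [div_le_iff₀ hsum]
    linarith
  · exact le_max_of_le_right (mul_nonneg (by linarith) (hx 0))
  · have hc : 2 * L * μ * α / (L + μ) - 1 = (2 * α * μ * L - L - μ) / (L + μ) := by
      field_simp
      ring
    rw [hc, div_mul_eq_mul_div, le_div_iff₀ hsum, mul_comm (α ^ 2 * Δ), ← mul_assoc,
      ← div_le_iff₀' hgap]
    exact le_max_left _ _
  · rw [div_div]
    exact hrec t
end
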